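/- Let K/F be a cyclic extension of degree 2 of number fields with h(F) odd. Then the 2-part of the ambiguous class group satisfies #Am₂(K/F) = 2^e, where e is the 2-rank of Cl(K). -/

import Mathlib

open NumberField
open scoped nonZeroDivisors

/-- In a quadratic Galois extension, some automorphism `τ` is such that every automorphism is `1`
or `τ`. -/
theorem exists_forall_gal_eq_one_or_eq {F K : Type*} [Field F] [Field K] [Algebra F K]
    [FiniteDimensional F K] [IsGalois F K] (hdeg : Module.finrank F K = 2) :
    ∃ τ : K ≃ₐ[F] K, ∀ σ : K ≃ₐ[F] K, σ = 1 ∨ σ = τ := by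
  have hcard : Nat.card (K ≃ₐ[F] K) = 2 := (IsGalois.card_aut_eq_finrank F K).trans hdeg
  obtain ⟨x, y, -, h⟩ := Nat.card_eq_two_iff.mp hcard
  have h' : ∀ σ : K ≃ₐ[F] K, σ = x ∨ σ = y := fun σ => by
    have : σ ∈ ({x, y} : Set _) := h ▸ Set.mem_univ σ
    simpa using this
  rcases h' 1 with h1 | h1
  · exact ⟨y, h1 ▸ h'⟩
  · exact ⟨x, fun σ => h1 ▸ (h' σ).symm⟩

/-- An element of a quadratic extension ring times its conjugate descends to the base. -/
theorem exists_algebraMap_eq_mul_conj {F K : Type*} [Field F] [Field K] [Algebra F K]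
    [FiniteDimensional F K] [IsGalois F K] {τ : K ≃ₐ[F] K}
    (hτ : ∀ σ : K ≃ₐ[F] K, σ = 1 ∨ σ = τ) (a : 𝓞 K) :
    ∃ n : 𝓞 F, algebraMap (𝓞 F) (𝓞 K) n = a * RingOfIntegers.mapRingHom τ a := by
  have hττ (x : K) : τ (τ x) = x := by
    rcases hτ (τ * τ) with h | h
    · exact DFunLike.congr_fun h x
    · have : τ = 1 := mul_eq_left.mp h
      simp [this]
  have hfix : ∀ σ : K ≃ₐ[F] K, σ ((a : K) * τ a) = (a : K) * τ a := fun σ => by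
    rcases hτ σ with rfl | rfl
    · simp
    · rw [map_mul, hττ, mul_comm]
  obtain ⟨n, hn⟩ := (IsGalois.mem_range_algebraMap_iff_fixed (F := F) _).mpr hfix
  have hint : IsIntegral ℤ n := by
    rw [← isIntegral_algebraMap_iff (algebraMap F K).injective, hn]
    exact (a * RingOfIntegers.mapRingHom τ a).isIntegral_coe
  exact ⟨⟨n, hint⟩, RingOfIntegers.ext hn⟩

/-- In a Dedekind domain, an element `x` lies in a nonzero ideal `A` as soon as some `y` satisfies
`x + y ∈ A` and `x * y ∈ A ^ 2`. -/
theorem mem_of_add_mem_of_mul_mem_sq {R : Type*} [CommRing R] [IsDedekindDomain R] {A : Ideal R}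
    (hA : A ≠ ⊥) {x y : R} (hadd : x + y ∈ A) (hmul : x * y ∈ A * A) : x ∈ A := by
  set B := A ⊔ Ideal.span {x}
  have hxB : x ∈ B := Ideal.mem_sup_right (Ideal.mem_span_singleton_self x)
  have hAB : A ≤ B := le_sup_left
  have hxx : x * x ∈ A * B := by
    have h : x * x = (x + y) * x - x * y := by ring
    rw [h]
    exact sub_mem (Ideal.mul_mem_mul hadd hxB) (Ideal.mul_mono_right hAB hmul)
  have hBB : B * B ≤ A * B := by
    conv_lhs => rw [show B * B = (A ⊔ Ideal.span {x}) * B from rfl, Ideal.sup_mul]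
    refine sup_le le_rfl ?_
    rw [show B = A ⊔ Ideal.span {x} from rfl, Ideal.mul_sup]
    refine sup_le ?_ ?_
    · rw [mul_comm]
      exact Ideal.mul_mono_right le_sup_right
    · rw [Ideal.span_singleton_mul_span_singleton, Ideal.span_singleton_le_iff_mem]
      exact hxx
  have hB : B ≠ ⊥ := ne_bot_of_le_ne_bot hA hAB
  have hdvd : A ∣ B := by
    rw [← Ideal.dvd_iff_le] at hBB
    exact (mul_dvd_mul_iff_right hB).mp hBB
  exact Ideal.dvd_iff_le.mp hdvd hxB

/-- In a quadratic extension of number fields, the product of an ideal and its conjugate is extended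
from the base. -/
theorem exists_map_eq_mul_map_conj {F K : Type*} [Field F] [Field K] [NumberField F]
    [NumberField K] [Algebra F K] [IsGalois F K]
    {τ : K ≃ₐ[F] K} (hτ : ∀ σ : K ≃ₐ[F] K, σ = 1 ∨ σ = τ) {I : Ideal (𝓞 K)} (hI : I ≠ ⊥) :
    ∃ J : Ideal (𝓞 F), J.map (algebraMap (𝓞 F) (𝓞 K)) =
      I * I.map (RingOfIntegers.mapRingHom τ) := by
  set t : 𝓞 K →+* 𝓞 K := RingOfIntegers.mapRingHom τ
  have ht : Function.Injective t := (RingOfIntegers.mapRingEquiv (τ : K ≃+* K)).injective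
  set J : Ideal (𝓞 F) := Ideal.span {n | ∃ a ∈ I, algebraMap (𝓞 F) (𝓞 K) n = a * t a}
  set A := J.map (algebraMap (𝓞 F) (𝓞 K))
  have hnorm {a : 𝓞 K} (ha : a ∈ I) : a * t a ∈ A := by
    obtain ⟨n, hn⟩ := exists_algebraMap_eq_mul_conj hτ a
    exact hn ▸ Ideal.mem_map_of_mem _ (Ideal.subset_span ⟨a, ha, hn⟩)
  have hA : A ≠ ⊥ := by
    obtain ⟨a, ha, ha0⟩ := Submodule.exists_mem_ne_zero_of_ne_bot hI
    refine Submodule.ne_bot_iff _ |>.mpr ⟨_, hnorm ha, mul_ne_zero ha0 ?_⟩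
    exact (map_ne_zero_iff t ht).mpr ha0
  refine ⟨J, le_antisymm ?_ ?_⟩
  · rw [Ideal.map_span, Ideal.span_le]
    rintro _ ⟨n, ⟨a, ha, hn⟩, rfl⟩
    rw [SetLike.mem_coe, hn]
    exact Ideal.mul_mem_mul ha (Ideal.mem_map_of_mem t ha)
  · have key : ∀ a ∈ I, ∀ b ∈ I, a * t b ∈ A := fun a ha b hb => by
      refine mem_of_add_mem_of_mul_mem_sq hA (y := b * t a) ?_ ?_
      · have h : a * t b + b * t a = (a + b) * t (a + b) - a * t a - b * t b := by
          rw [map_add]; ring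
        rw [h]
        exact sub_mem (sub_mem (hnorm (add_mem ha hb)) (hnorm ha)) (hnorm hb)
      · rw [show a * t b * (b * t a) = a * t a * (b * t b) by ring]
        exact Ideal.mul_mem_mul (hnorm ha) (hnorm hb)
    rw [Ideal.mul_le]
    intro a ha s hs
    refine Submodule.span_induction ?_ (by simp) ?_ ?_ hs
    · rintro _ ⟨b, hb, rfl⟩
      exact key a ha b hb
    · intro x y _ _ hx hy
      rw [mul_add]
      exact add_mem hx hy
    · intro r x _ hx
      rw [smul_eq_mul, mul_left_comm]
      exact A.mul_mem_left r hx

/-- The product of a class with its conjugate is killed by the class number of the base. -/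
theorem mk0_mul_mk0_conj_pow_card {F K : Type*} [Field F] [Field K] [NumberField F]
    [NumberField K] [Algebra F K] [IsGalois F K]
    {τ : K ≃ₐ[F] K} (hτ : ∀ σ : K ≃ₐ[F] K, σ = 1 ∨ σ = τ) {I J : (Ideal (𝓞 K))⁰}
    (hJ : (J : Ideal (𝓞 K)) = Ideal.map (RingOfIntegers.mapRingHom τ) (I : Ideal (𝓞 K))) :
    (ClassGroup.mk0 I * ClassGroup.mk0 J) ^ Nat.card (ClassGroup (𝓞 F)) = 1 := by
  obtain ⟨A, hA⟩ := exists_map_eq_mul_map_conj hτ (nonZeroDivisors.coe_ne_zero I)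
  have hA0 : A ∈ (Ideal (𝓞 F))⁰ := by
    rw [mem_nonZeroDivisors_iff_ne_zero]
    rintro rfl
    rw [← hJ, Ideal.zero_eq_bot, Ideal.map_bot] at hA
    exact nonZeroDivisors.coe_ne_zero (I * J) hA.symm
  have h1 := pow_card_eq_one' (x := ClassGroup.mk0 ⟨A, hA0⟩)
  rw [← map_pow, ClassGroup.mk0_eq_one_iff (SetLike.coe_mem _)] at h1
  rw [← map_mul, ← map_pow, ClassGroup.mk0_eq_one_iff (SetLike.coe_mem _)]
  simp only [SubmonoidClass.coe_pow, Submonoid.coe_mul, hJ, ← hA] at h1 ⊢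
  rw [← Ideal.map_pow]
  exact h1.map_ringHom _

/-- In a finite commutative group, the `n`-torsion has as many elements as the quotient by `n`-th
powers. -/
theorem card_ker_powMonoidHom_eq {G : Type*} [CommGroup G] [Finite G] (n : ℕ) :
    Nat.card (powMonoidHom n : G →* G).ker = Nat.card (G ⧸ (powMonoidHom n : G →* G).range) := by
  set f : G →* G := powMonoidHom n
  have h := f.ker.card_mul_index.trans f.range.card_mul_index.symm
  rw [Subgroup.index_ker, mul_comm] at h
  exact Nat.eq_of_mul_eq_mul_left Nat.card_pos h

/-- An element killed by an odd number and by a power of two is trivial. -/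
theorem eq_one_of_odd_pow_of_two_pow {G : Type*} [Group G] {x : G} {m n : ℕ} (hm : Odd m)
    (h₁ : x ^ m = 1) (h₂ : x ^ 2 ^ n = 1) : x = 1 :=
  orderOf_eq_one_iff.mp <| Nat.eq_one_of_dvd_coprimes (hm.coprime_two_right.pow_right n)
    (orderOf_dvd_of_pow_eq_one h₁) (orderOf_dvd_of_pow_eq_one h₂)

/-- Let `K/F` be a cyclic (Galois) extension of number fields of degree 2 with `h(F)`
odd. Then the 2-part `Am₂` of the group of ambiguous ideal classes (classes fixed by
the Galois action) satisfies `#Am₂ = 2^e`, where `e` is the 2-rank of `Cl(K)`, i.e.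
`#(Cl(K)/Cl(K)²) = 2^e`. -/
theorem card_ambiguous_two_part (F K : Type*) [Field F] [Field K] [NumberField F]
    [NumberField K] [Algebra F K] [IsGalois F K]
    (hdeg : Module.finrank F K = 2)
    (hodd : Odd (Nat.card (ClassGroup (𝓞 F))))
    (e : ℕ)
    (he : Nat.card (ClassGroup (𝓞 K) ⧸
      (MonoidHom.range (powMonoidHom 2 : ClassGroup (𝓞 K) →* ClassGroup (𝓞 K)))) = 2 ^ e) :
    Nat.card {c : ClassGroup (𝓞 K) |
      (∀ (σ : K ≃ₐ[F] K) (I J : (Ideal (𝓞 K))⁰), ClassGroup.mk0 I = c →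
        (J : Ideal (𝓞 K)) =
          Ideal.map (RingOfIntegers.mapRingHom σ) (I : Ideal (𝓞 K)) →
        ClassGroup.mk0 J = c) ∧ ∃ n : ℕ, c ^ 2 ^ n = 1} = 2 ^ e := by
  rw [← he, ← card_ker_powMonoidHom_eq]
  obtain ⟨τ, hτ⟩ := exists_forall_gal_eq_one_or_eq hdeg
  refine Nat.card_congr (Equiv.setCongr (Set.ext fun c => ?_))
  rw [SetLike.mem_coe, MonoidHom.mem_ker, powMonoidHom_apply]
  constructor
  · rintro ⟨hc, n, hn⟩
    obtain ⟨I, rfl⟩ := ClassGroup.mk0_surjective c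
    have hinj : Function.Injective (RingOfIntegers.mapRingHom (τ : K →+* K)) :=
      (RingOfIntegers.mapRingEquiv (τ : K ≃+* K)).injective
    have hJ0 : Ideal.map (RingOfIntegers.mapRingHom τ) (I : Ideal (𝓞 K)) ∈ (Ideal (𝓞 K))⁰ :=
      mem_nonZeroDivisors_iff_ne_zero.mpr
        ((Ideal.map_eq_bot_iff_of_injective hinj).not.mpr (nonZeroDivisors.coe_ne_zero I))
    have h := mk0_mul_mk0_conj_pow_card hτ (I := I) (J := ⟨_, hJ0⟩) rfl
    rw [hc τ I ⟨_, hJ0⟩ rfl rfl, ← sq] at h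
    exact eq_one_of_odd_pow_of_two_pow hodd h (n := n) (by rw [pow_right_comm, hn, one_pow])
  · intro hc
    refine ⟨fun σ I J hI hJ => ?_, 1, by simpa using hc⟩
    rcases hτ σ with rfl | rfl
    · have hid : RingOfIntegers.mapRingHom (1 : K ≃ₐ[F] K) = RingHom.id (𝓞 K) := rfl
      rw [hid, Ideal.map_id] at hJ
      rw [Subtype.ext hJ, hI]
    · have h := mk0_mul_mk0_conj_pow_card hτ hJ
      have hJ2 : ClassGroup.mk0 J ^ 2 = 1 := by
        rw [← hI, ← map_pow, ClassGroup.mk0_eq_one_iff (SetLike.coe_mem _)] at hc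
        rw [← map_pow, ClassGroup.mk0_eq_one_iff (SetLike.coe_mem _)]
        simp only [SubmonoidClass.coe_pow, hJ] at hc ⊢
        rw [← Ideal.map_pow]
        exact hc.map_ringHom _
      rw [hI] at h
      have h1 := eq_one_of_odd_pow_of_two_pow hodd h (n := 1)
        (by rw [pow_one, mul_pow, hc, hJ2, one_mul])
      rw [← mul_right_inj c, h1, ← sq, hc]
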